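/- Let 0 ≤ α < d, 1 < p ≤ q < ∞ with 1/p − 1/q ≤ α/d, let Φ and Ψ be Young functions, let 𝒟 be a dyadic grid, and let (U,V) be matrix weights satisfying [U,V]_{p,q,Φ,Ψ} := sup_Q |Q|^{α/d + 1/q − 1/p} ‖ ‖U(x)^{1/q} V(y)^{−1/p}‖_{Φ_y,Q} ‖_{Ψ_x,Q} < ∞ (inner Orlicz norm in y, outer in x, supremum over all cubes). For Q ∈ 𝒟 define N_Q(x) = sup{ |R|^{α/d + 1/q − 1/p} |U(x)^{1/q} 𝒱_R^Φ|_op : R ∈ 𝒟, R ⊆ Q, x ∈ R }, where 𝒱_R^Φ is a reducing operator of V^{−1/p} with respect to Φ. Then sup_{Q∈𝒟} ‖N_Q‖_{Ψ,Q} < ∞. -/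

import Mathlib

open MeasureTheory ENNReal
open scoped NNReal ComplexOrder

noncomputable section

abbrev Rd (d : ℕ) := EuclideanSpace ℝ (Fin d)
abbrev Cn (n : ℕ) := EuclideanSpace ℂ (Fin n)
abbrev Mat (n : ℕ) := Matrix (Fin n) (Fin n) ℂ

/-- An axis-parallel (half-open) cube in `ℝ^d`. -/
structure Cube (d : ℕ) where
  corner : Fin d → ℝ
  side : ℝ
  side_pos : 0 < side

namespace Cube

/-- The set of points of a cube. -/
def set {d : ℕ} (Q : Cube d) : Set (Rd d) :=
  {x | ∀ i, Q.corner i ≤ x i ∧ x i < Q.corner i + Q.side}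

/-- The volume `|Q|` of a cube. -/
def vol {d : ℕ} (Q : Cube d) : ℝ := Q.side ^ d

end Cube

/-- A matrix acting on `ℂ^n` (with the Euclidean norm). -/
def mulVecE {n : ℕ} (A : Mat n) (v : Cn n) : Cn n :=
  Matrix.toEuclideanLin A v

/-- The operator norm `|A|_op` of a matrix acting on `ℓ²(ℂ^n)`. -/
def opNorm {n : ℕ} (A : Mat n) : ℝ :=
  ‖Matrix.toEuclideanCLM (𝕜 := ℂ) A‖

/-- Real powers of a self-adjoint matrix, defined via diagonalization. -/
def matPow {n : ℕ} (A : Mat n) (r : ℝ) : Mat n :=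
  if hA : A.IsHermitian then
    (hA.eigenvectorUnitary : Mat n) *
      Matrix.diagonal (fun i => ((hA.eigenvalues i ^ r : ℝ) : ℂ)) *
      (star hA.eigenvectorUnitary : Mat n)
  else A

/-- A matrix weight: self-adjoint matrix valued, locally integrable entries,
positive definite a.e. -/
def IsMatrixWeight {d n : ℕ} (U : Rd d → Mat n) : Prop :=
  (∀ i j, MeasureTheory.LocallyIntegrable (fun x => U x i j) volume) ∧
    (∀ᵐ x, (U x).PosDef)

/-- A Young function: convex, increasing, `Φ(0) = 0` and `Φ(t)/t → ∞`. -/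
structure IsYoungFunction (Φ : ℝ → ℝ) : Prop where
  convexOn : ConvexOn ℝ (Set.Ici 0) Φ
  monotoneOn : MonotoneOn Φ (Set.Ici 0)
  map_zero : Φ 0 = 0
  tendsto : Filter.Tendsto (fun t => Φ t / t) Filter.atTop Filter.atTop

/-- The associate Young function `Φ̄(t) = sup_{s>0} (st - Φ(s))`. -/
def assoc (Φ : ℝ → ℝ) : ℝ → ℝ :=
  fun t => sSup ((fun s => s * t - Φ s) '' Set.Ioi (0 : ℝ))

/-- The `B_{p,q}` condition: `∫_1^∞ Φ(t)^{q/p} t^{-q} dt/t < ∞`. -/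
def MemBpq (Φ : ℝ → ℝ) (p q : ℝ) : Prop :=
  ∫⁻ t in Set.Ioi (1 : ℝ), ENNReal.ofReal (Φ t ^ (q / p) / t ^ (q + 1)) < ⊤

/-- The `B_p` condition: `∫_1^∞ Φ(t) t^{-p} dt/t < ∞`. -/
def MemBp (Φ : ℝ → ℝ) (p : ℝ) : Prop :=
  ∫⁻ t in Set.Ioi (1 : ℝ), ENNReal.ofReal (Φ t / t ^ (p + 1)) < ⊤

/-- Localized Luxemburg (Orlicz) norm over a cube, for `ℝ≥0∞`-valued functions. -/
def luxNormE {d : ℕ} (Φ : ℝ → ℝ) (Q : Cube d) (f : Rd d → ℝ≥0∞) : ℝ≥0∞ :=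
  sInf {lam : ℝ≥0∞ | 0 < lam ∧ lam < ⊤ ∧
    (∫⁻ x in Q.set, ENNReal.ofReal (Φ ((f x).toReal / lam.toReal))) ≤ ENNReal.ofReal Q.vol}

/-- Localized Luxemburg (Orlicz) norm over a cube of a real valued function. -/
def luxNorm {d : ℕ} (Φ : ℝ → ℝ) (Q : Cube d) (f : Rd d → ℝ) : ℝ≥0∞ :=
  luxNormE Φ Q fun x => ENNReal.ofReal |f x|

/-- The (unweighted) `L^p` norm of a vector valued function. -/
def lpNorm {d n : ℕ} (p : ℝ) (f : Rd d → Cn n) : ℝ≥0∞ :=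
  (∫⁻ x, (‖f x‖₊ : ℝ≥0∞) ^ p) ^ (1 / p)

/-- The matrix-weighted `L^p(W)` norm `(∫ |W^{1/p} f|^p)^{1/p}`. -/
def wLpNorm {d n : ℕ} (p : ℝ) (W : Rd d → Mat n) (f : Rd d → Cn n) : ℝ≥0∞ :=
  (∫⁻ x, (‖mulVecE (matPow (W x) (1 / p)) (f x)‖₊ : ℝ≥0∞) ^ p) ^ (1 / p)

/-- A dyadic grid: side lengths are powers of two, cubes are nested or disjoint,
and the cubes of a fixed side length `2^k` partition `ℝ^d`. -/
def IsDyadicGrid {d : ℕ} (𝒟 : Set (Cube d)) : Prop :=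
  (∀ Q ∈ 𝒟, ∃ k : ℤ, Q.side = (2 : ℝ) ^ k) ∧
  (∀ Q ∈ 𝒟, ∀ R ∈ 𝒟, Q.set ⊆ R.set ∨ R.set ⊆ Q.set ∨ Disjoint Q.set R.set) ∧
  (∀ (k : ℤ) (x : Rd d), ∃! Q : Cube d, Q ∈ 𝒟 ∧ Q.side = (2 : ℝ) ^ k ∧ x ∈ Q.set)

/-- `M` is a reducing operator of the matrix function `A` with respect to the Young function `Φ`
on the cube `Q`, with comparability constants `c₁, c₂`:  `|M e| ≈ ‖A e‖_{Φ,Q}` for all `e`. -/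
def ReducesOrlicz {d n : ℕ} (c₁ c₂ : ℝ) (Φ : ℝ → ℝ) (A : Rd d → Mat n) (Q : Cube d)
    (M : Mat n) : Prop :=
  M.PosDef ∧ ∀ e : Cn n,
    ENNReal.ofReal c₁ * luxNorm Φ Q (fun x => ‖mulVecE (A x) e‖) ≤ (‖mulVecE M e‖₊ : ℝ≥0∞) ∧
    (‖mulVecE M e‖₊ : ℝ≥0∞) ≤ ENNReal.ofReal c₂ * luxNorm Φ Q (fun x => ‖mulVecE (A x) e‖)

/-- The bump constant `[U,V]_{p,q,Φ,Ψ}` of (1.2): inner Orlicz norm in `y`, outer in `x`. -/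
def bumpTwo {d n : ℕ} (α p q : ℝ) (Φ Ψ : ℝ → ℝ) (U V : Rd d → Mat n) : ℝ≥0∞ :=
  ⨆ Q : Cube d,
    ENNReal.ofReal (Q.vol ^ (α / (d : ℝ) + 1 / q - 1 / p)) *
      luxNormE Ψ Q fun x =>
        luxNorm Φ Q fun y => opNorm (matPow (U x) (1 / q) * matPow (V y) (-(1 / p)))

/-- The maximal-type function `N_Q` of (3.1). -/
def NQfun {d n : ℕ} (α p q : ℝ) (𝒟 : Set (Cube d)) (U : Rd d → Mat n) (𝒱 : Cube d → Mat n)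
    (Q : Cube d) (x : Rd d) : ℝ≥0∞ :=
  ⨆ (R : Cube d) (_ : R ∈ 𝒟) (_ : R.set ⊆ Q.set) (_ : x ∈ R.set),
    ENNReal.ofReal (R.vol ^ (α / (d : ℝ) + 1 / q - 1 / p) * opNorm (matPow (U x) (1 / q) * 𝒱 R))

theorem Cube.mem_set {d : ℕ} {Q : Cube d} {x : Rd d} :
    x ∈ Q.set ↔ ∀ i, Q.corner i ≤ x i ∧ x i < Q.corner i + Q.side := Iff.rfl

theorem Cube.measurableSet_set {d : ℕ} (Q : Cube d) : MeasurableSet Q.set := by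
  have h : Q.set = ⋂ i, {x : Rd d | Q.corner i ≤ x i ∧ x i < Q.corner i + Q.side} := by
    ext x
    simp [Cube.mem_set]
  rw [h]
  refine MeasurableSet.iInter fun i => ?_
  have hm : Measurable fun x : Rd d => x i := by fun_prop
  exact (measurableSet_le measurable_const hm).inter (measurableSet_lt hm measurable_const)

theorem Cube.vol_pos {d : ℕ} (Q : Cube d) : 0 < Q.vol := pow_pos Q.side_pos _

theorem Cube.corner_mem {d : ℕ} (Q : Cube d) : WithLp.toLp 2 Q.corner ∈ Q.set :=
  fun _ => ⟨le_rfl, lt_add_of_pos_right _ Q.side_pos⟩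

theorem Cube.side_le_of_subset {d : ℕ} (hd : 0 < d) {R Q : Cube d} (h : R.set ⊆ Q.set) :
    R.side ≤ Q.side := by
  have h0 := (h R.corner_mem ⟨0, hd⟩).1
  refine le_of_forall_lt fun s hs => ?_
  rcases lt_or_ge s 0 with hs0 | hs0
  · exact hs0.trans Q.side_pos
  have hmem : WithLp.toLp 2 (fun i => R.corner i + s) ∈ R.set := fun i =>
    ⟨le_add_of_nonneg_right hs0, by simpa using hs⟩
  have h1 := (h hmem ⟨0, hd⟩).2
  simp only at h0 h1
  linarith

theorem Cube.exists_mem_dense {d : ℕ} (Q : Cube d) {s : Set (Rd d)} (hs : Dense s) :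
    ∃ x ∈ s, x ∈ Q.set := by
  have ho : IsOpen (⋂ i, {x : Rd d | Q.corner i < x i ∧ x i < Q.corner i + Q.side}) := by
    refine isOpen_iInter_of_finite fun i => ?_
    have hc : Continuous fun x : Rd d => x i := by fun_prop
    exact (isOpen_lt continuous_const hc).inter (isOpen_lt hc continuous_const)
  obtain ⟨x, hx, hxs⟩ := hs.inter_open_nonempty _ ho
    ⟨WithLp.toLp 2 (fun i => Q.corner i + Q.side / 2), by
      have := Q.side_pos
      simp only [Set.mem_iInter, Set.mem_ofPred_eq]
      exact fun i => ⟨by linarith, by linarith⟩⟩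
  rw [Set.mem_iInter] at hx
  exact ⟨x, hxs, fun i => ⟨(hx i).1.le, (hx i).2⟩⟩

namespace IsDyadicGrid

variable {d : ℕ} {𝒟 : Set (Cube d)}

theorem eq_of_side_eq (h : IsDyadicGrid 𝒟) {R Q : Cube d} (hR : R ∈ 𝒟) (hQ : Q ∈ 𝒟)
    (hs : R.side = Q.side) {x : Rd d} (hxR : x ∈ R.set) (hxQ : x ∈ Q.set) : R = Q := by
  obtain ⟨k, hk⟩ := h.1 Q hQ
  exact (h.2.2 k x).unique ⟨hR, hs.trans hk, hxR⟩ ⟨hQ, hk, hxQ⟩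

theorem two_mul_side_le (h : IsDyadicGrid 𝒟) (hd : 0 < d) {R Q : Cube d} (hR : R ∈ 𝒟)
    (hQ : Q ∈ 𝒟) (hRQ : R.set ⊆ Q.set) (hne : R ≠ Q) : 2 * R.side ≤ Q.side := by
  obtain ⟨k, hk⟩ := h.1 Q hQ
  obtain ⟨j, hj⟩ := h.1 R hR
  have hlt : R.side < Q.side := (Cube.side_le_of_subset hd hRQ).lt_of_ne fun he =>
    hne (h.eq_of_side_eq hR hQ he R.corner_mem (hRQ R.corner_mem))
  rw [hk, hj, zpow_lt_zpow_iff_right₀ _root_.one_lt_two] at hlt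
  rw [hk, hj, ← zpow_one_add₀ two_ne_zero]
  exact zpow_le_zpow_right₀ one_le_two (by lia)

theorem countable (h : IsDyadicGrid 𝒟) : 𝒟.Countable := by
  obtain ⟨s, hsc, hsd⟩ := TopologicalSpace.exists_countable_dense (Rd d)
  choose c hc using fun (y : ℤ × Rd d) => (h.2.2 y.1 y.2).exists
  refine (((Set.countable_univ (α := ℤ)).prod hsc).image c).mono fun Q hQ => ?_
  obtain ⟨k, hk⟩ := h.1 Q hQ
  obtain ⟨x, hxs, hxQ⟩ := Q.exists_mem_dense hsd
  exact ⟨(k, x), ⟨trivial, hxs⟩, h.eq_of_side_eq (hc (k, x)).1 hQ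
    ((hc (k, x)).2.1.trans hk.symm) (hc (k, x)).2.2 hxQ⟩

/-- Among the cubes of a subfamily of a dyadic grid that lie in a fixed cube, every cube is
contained in a maximal one. -/
theorem exists_maximal (h : IsDyadicGrid 𝒟) (hd : 0 < d) {Q : Cube d} {S : Set (Cube d)}
    (hS : ∀ R ∈ S, R ∈ 𝒟 ∧ R.set ⊆ Q.set) {R : Cube d} (hR : R ∈ S) :
    ∃ R' ∈ S, R.set ⊆ R'.set ∧ ∀ R'' ∈ S, R'.set ⊆ R''.set → R'' = R' := by
  choose! e he using h.1
  obtain ⟨k, hk⟩ : ∃ k : ℤ, Q.side < (2 : ℝ) ^ k := by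
    obtain ⟨k, hk⟩ := pow_unbounded_of_one_lt Q.side _root_.one_lt_two
    exact ⟨k, by exact_mod_cast hk⟩
  obtain ⟨j, ⟨R', hR', hRR', rfl⟩, hmax⟩ := Int.exists_greatest_of_bdd
    (P := fun j => ∃ R' ∈ S, R.set ⊆ R'.set ∧ e R' = j)
    ⟨k, by
      rintro _ ⟨R', hR', -, rfl⟩
      have := (Cube.side_le_of_subset hd (hS R' hR').2).trans_lt hk
      rw [he R' (hS R' hR').1, zpow_lt_zpow_iff_right₀ _root_.one_lt_two] at this
      exact this.le⟩
    ⟨e R, R, hR, subset_rfl, rfl⟩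
  refine ⟨R', hR', hRR', fun R'' hR'' hsub => ?_⟩
  have h1 := hmax _ ⟨R'', hR'', hRR'.trans hsub, rfl⟩
  refine (h.eq_of_side_eq (hS R' hR').1 (hS R'' hR'').1 ?_ R'.corner_mem
    (hsub R'.corner_mem)).symm
  refine le_antisymm (Cube.side_le_of_subset hd hsub) ?_
  rw [he _ (hS R' hR').1, he _ (hS R'' hR'').1]
  exact zpow_le_zpow_right₀ one_le_two h1

end IsDyadicGrid

/-- The supremum of the functions `F R`, localized to `R`, over the cubes `R ∈ 𝒟` with `R ⊆ Q`
and side length at least `s`. -/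
def truncMax {d : ℕ} (𝒟 : Set (Cube d)) (F : Cube d → Rd d → ℝ≥0∞) (s : ℝ) (Q : Cube d)
    (x : Rd d) : ℝ≥0∞ :=
  ⨆ R ∈ {R : Cube d | R ∈ 𝒟 ∧ R.set ⊆ Q.set ∧ s ≤ R.side}, R.set.indicator (F R) x

theorem le_truncMax {d : ℕ} {𝒟 : Set (Cube d)} (F : Cube d → Rd d → ℝ≥0∞) {s : ℝ}
    {Q R : Cube d} {x : Rd d} (hR : R ∈ 𝒟) (hRQ : R.set ⊆ Q.set) (hs : s ≤ R.side)
    (hx : x ∈ R.set) : F R x ≤ truncMax 𝒟 F s Q x := by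
  rw [← Set.indicator_of_mem hx (F R)]
  exact le_iSup₂_of_le R ⟨hR, hRQ, hs⟩ le_rfl

theorem aemeasurable_truncMax {d : ℕ} {𝒟 : Set (Cube d)} (h𝒟 : IsDyadicGrid 𝒟)
    {F : Cube d → Rd d → ℝ≥0∞} (hF : ∀ R ∈ 𝒟, AEMeasurable (F R)) (s : ℝ) (Q : Cube d) :
    AEMeasurable (truncMax 𝒟 F s Q) :=
  AEMeasurable.biSup _ (h𝒟.countable.mono fun _ h => h.1) fun R hR =>
    (hF R hR.1).indicator R.measurableSet_set

/-- A stopping time argument: outside of the stopping cubes `jump Q R`, which are sparse, the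
functions `F R` with `R ⊆ Q` are dominated by `E Q`. -/
theorem setLIntegral_truncMax_le {d : ℕ} (hd : 0 < d) {𝒟 : Set (Cube d)}
    (h𝒟 : IsDyadicGrid 𝒟) {F E : Cube d → Rd d → ℝ≥0∞} {jump : Cube d → Cube d → Prop}
    (hF : ∀ R ∈ 𝒟, AEMeasurable (F R)) (hE : ∀ R ∈ 𝒟, AEMeasurable (E R))
    (hEint : ∀ Q ∈ 𝒟, ∫⁻ x in Q.set, E Q x ≤ ENNReal.ofReal Q.vol)
    (hdom : ∀ Q ∈ 𝒟, ∀ R ∈ 𝒟, R.set ⊆ Q.set → ¬ jump Q R → ∀ x, F R x ≤ E Q x)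
    (hself : ∀ Q ∈ 𝒟, ¬ jump Q Q)
    (hsparse : ∀ Q ∈ 𝒟, ∀ M : Set (Cube d), M ⊆ {R | R ∈ 𝒟 ∧ R.set ⊆ Q.set ∧ jump Q R} →
      M.PairwiseDisjoint Cube.set →
      2 * ∑' R : M, ENNReal.ofReal (R : Cube d).vol ≤ ENNReal.ofReal Q.vol)
    {s : ℝ} (hs : 0 < s) {Q : Cube d} (hQ : Q ∈ 𝒟) :
    ∫⁻ x in Q.set, truncMax 𝒟 F s Q x ≤ 2 * ENNReal.ofReal Q.vol := by
  suffices H : ∀ N : ℕ, ∀ Q ∈ 𝒟, Q.side < s * 2 ^ N →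
      ∫⁻ x in Q.set, truncMax 𝒟 F s Q x ≤ 2 * ENNReal.ofReal Q.vol by
    obtain ⟨N, hN⟩ := pow_unbounded_of_one_lt (Q.side / s) _root_.one_lt_two
    exact H N Q hQ (by rwa [div_lt_iff₀' hs] at hN)
  intro N
  induction N with
  | zero =>
    intro Q _ hlt
    have h0 : ∀ x, truncMax 𝒟 F s Q x = 0 := fun x => by
      simp only [truncMax, Set.mem_ofPred_eq, iSup_eq_zero]
      rintro R ⟨-, hRQ, hsR⟩
      have := Cube.side_le_of_subset hd hRQ
      linarith
    simp [h0]
  | succ N ih =>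
    intro Q hQ hlt
    set S : Set (Cube d) := {R | R ∈ 𝒟 ∧ R.set ⊆ Q.set ∧ jump Q R}
    set M : Set (Cube d) := {R | R ∈ S ∧ ∀ R' ∈ S, R.set ⊆ R'.set → R' = R}
    have hMS : M ⊆ S := fun R hR => hR.1
    have hMc : M.Countable := h𝒟.countable.mono fun R hR => hR.1.1
    have : Countable M := hMc.to_subtype
    have hdisj : M.PairwiseDisjoint Cube.set := by
      intro R hR R' hR' hne
      rcases h𝒟.2.1 R hR.1.1 R' hR'.1.1 with h | h | h
      · exact absurd (hR.2 R' hR'.1 h).symm hne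
      · exact absurd (hR'.2 R hR.1 h) hne
      · exact h
    have hpt : ∀ x, truncMax 𝒟 F s Q x ≤
        E Q x + ∑' R : M, (R : Cube d).set.indicator (truncMax 𝒟 F s R) x := by
      intro x
      refine iSup₂_le fun R hR => Set.indicator_apply_le' (fun hx => ?_) (fun _ => bot_le)
      by_cases hjump : jump Q R
      · obtain ⟨R', hR'S, hRR', hmax⟩ := h𝒟.exists_maximal hd (S := S) (Q := Q)
          (fun R hR => ⟨hR.1, hR.2.1⟩) (R := R) ⟨hR.1, hR.2.1, hjump⟩
        refine le_add_left ((le_truncMax F hR.1 hRR' hR.2.2 hx).trans ?_)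
        rw [← Set.indicator_of_mem (hRR' hx) (truncMax 𝒟 F s R')]
        exact ENNReal.le_tsum (f := fun R : M => (R : Cube d).set.indicator
          (truncMax 𝒟 F s R) x) ⟨R', hR'S, hmax⟩
      · exact le_add_right (hdom Q hQ R hR.1 hR.2.1 hjump x)
    calc ∫⁻ x in Q.set, truncMax 𝒟 F s Q x
        ≤ ∫⁻ x in Q.set, (E Q x +
            ∑' R : M, (R : Cube d).set.indicator (truncMax 𝒟 F s R) x) := lintegral_mono hpt
      _ = (∫⁻ x in Q.set, E Q x) +
            ∑' R : M, ∫⁻ x in Q.set, (R : Cube d).set.indicator (truncMax 𝒟 F s R) x := by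
          rw [lintegral_add_left' (hE Q hQ).restrict, lintegral_tsum fun R : M =>
            ((aemeasurable_truncMax h𝒟 hF s R).indicator R.1.measurableSet_set).restrict]
      _ ≤ ENNReal.ofReal Q.vol + ∑' R : M, 2 * ENNReal.ofReal (R : Cube d).vol := by
          refine add_le_add (hEint Q hQ) (ENNReal.tsum_le_tsum fun R => ?_)
          refine (setLIntegral_le_lintegral _ _).trans ?_
          rw [lintegral_indicator R.1.measurableSet_set]
          have hRS := hMS R.2
          refine ih R hRS.1 ?_
          have := h𝒟.two_mul_side_le hd hRS.1 hQ hRS.2.1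
            (fun h => hself Q hQ (h ▸ hRS.2.2))
          rw [pow_succ] at hlt
          linarith
      _ ≤ ENNReal.ofReal Q.vol + ENNReal.ofReal Q.vol := by
          rw [ENNReal.tsum_mul_left]
          gcongr
          exact hsparse Q hQ M hMS hdisj
      _ = 2 * ENNReal.ofReal Q.vol := (two_mul _).symm

theorem setLIntegral_iSup_truncMax_le {d : ℕ} {𝒟 : Set (Cube d)} (h𝒟 : IsDyadicGrid 𝒟)
    {F : Cube d → Rd d → ℝ≥0∞} (hF : ∀ R ∈ 𝒟, AEMeasurable (F R)) {Q : Cube d} {C : ℝ≥0∞}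
    (h : ∀ s : ℝ, 0 < s → ∫⁻ x in Q.set, truncMax 𝒟 F s Q x ≤ C) :
    ∫⁻ x in Q.set, ⨆ k : ℕ, truncMax 𝒟 F (1 / ((k : ℝ) + 1)) Q x ≤ C := by
  rw [lintegral_iSup' (fun k => (aemeasurable_truncMax h𝒟 hF _ Q).restrict)]
  · exact iSup_le fun k => h _ Nat.one_div_pos_of_nat
  · refine Filter.Eventually.of_forall fun x j k hjk => ?_
    exact biSup_mono fun R hR => ⟨hR.1, hR.2.1, (Nat.one_div_le_one_div hjk).trans hR.2.2⟩

section MatrixNorm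

open scoped Matrix.Norms.L2Operator Topology

variable {n : ℕ}

theorem opNorm_eq_norm (A : Mat n) : opNorm A = ‖A‖ := rfl

theorem opNorm_nonneg (A : Mat n) : 0 ≤ opNorm A := norm_nonneg _

theorem opNorm_mul_le (A B : Mat n) : opNorm (A * B) ≤ opNorm A * opNorm B := by
  simpa only [opNorm_eq_norm] using norm_mul_le A B

theorem opNorm_one_le (n : ℕ) : opNorm (1 : Mat n) ≤ 1 := by
  rw [opNorm, map_one]
  exact ContinuousLinearMap.norm_id_le

theorem continuous_opNorm : Continuous (opNorm (n := n)) :=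
  (continuous_norm : Continuous fun A : Mat n => ‖A‖)

theorem opNorm_conjTranspose (A : Mat n) : opNorm A.conjTranspose = opNorm A := by
  simpa only [opNorm_eq_norm] using Matrix.l2_opNorm_conjTranspose A

theorem norm_mulVecE_le (A : Mat n) (v : Cn n) : ‖mulVecE A v‖ ≤ opNorm A * ‖v‖ :=
  (Matrix.toEuclideanCLM (𝕜 := ℂ) A).le_opNorm v

theorem mulVecE_mulVecE (A B : Mat n) (v : Cn n) : mulVecE A (mulVecE B v) = mulVecE (A * B) v := by
  simp [mulVecE, Matrix.toLpLin_apply, Matrix.mulVec_mulVec]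

theorem continuous_mulVecE (v : Cn n) : Continuous fun A : Mat n => mulVecE A v := by
  have h : (fun A : Mat n => mulVecE A v) = fun A : Mat n => WithLp.toLp 2 (A.mulVec v) := rfl
  rw [h]
  fun_prop

theorem opNorm_le_sum (A : Mat n) :
    opNorm A ≤ ∑ i, ‖mulVecE A (EuclideanSpace.single i 1)‖ := by
  refine ContinuousLinearMap.opNorm_le_bound _ (Finset.sum_nonneg fun _ _ => norm_nonneg _)
    fun v => ?_
  have hv : v = ∑ i, v i • EuclideanSpace.single i (1 : ℂ) := by
    ext j
    simp [Pi.single_apply]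
  have hA : Matrix.toEuclideanCLM (𝕜 := ℂ) A v =
      ∑ i, v i • mulVecE A (EuclideanSpace.single i 1) := by
    conv_lhs => rw [hv, map_sum]
    exact Finset.sum_congr rfl fun i _ => map_smul _ _ _
  rw [hA, Finset.sum_mul]
  refine (norm_sum_le _ _).trans (Finset.sum_le_sum fun i _ => ?_)
  rw [norm_smul, mul_comm]
  gcongr
  exact PiLp.norm_apply_le v i

theorem matPow_eq_cfc {A : Mat n} (hA : A.IsHermitian) (r : ℝ) :
    matPow A r = cfc (fun t : ℝ => t ^ r) A := by
  rw [hA.cfc_eq, matPow, dif_pos hA]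
  rfl

theorem isHermitian_matPow {A : Mat n} (hA : A.IsHermitian) (r : ℝ) :
    (matPow A r).IsHermitian := by
  rw [matPow_eq_cfc hA]
  exact cfc_predicate (p := IsSelfAdjoint) _ A

theorem continuous_cfc_selfAdjointPart (f : ℝ → ℝ) (hf : Continuous f) :
    Continuous fun A : Mat n => cfc f ((1 / 2 : ℝ) • (A + A.conjTranspose)) := by
  refine Continuous.cfc_of_mem_nhdsSet (s := Set.univ) f Filter.univ_mem (by fun_prop) ?_
    hf.continuousOn
  intro A
  exact (IsSelfAdjoint.all (1 / 2 : ℝ)).smul (IsSelfAdjoint.add_star_self A)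

theorem tendsto_cfc_max_rpow {A : Mat n} (hA : A.PosDef) (r : ℝ) :
    Filter.Tendsto (fun k : ℕ => cfc (fun t : ℝ => (max t (1 / ((k : ℝ) + 1))) ^ r)
      ((1 / 2 : ℝ) • (A + A.conjTranspose))) Filter.atTop (𝓝 (matPow A r)) := by
  have hself : (1 / 2 : ℝ) • (A + A.conjTranspose) = A := by
    rw [hA.isHermitian.eq, ← two_smul ℝ A, smul_smul]
    norm_num
  rw [hself, matPow_eq_cfc hA.isHermitian]
  have hev : ∀ᶠ k : ℕ in Filter.atTop, ∀ i, 1 / ((k : ℝ) + 1) ≤ hA.isHermitian.eigenvalues i :=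
    Filter.eventually_all.2 fun i =>
      tendsto_one_div_add_atTop_nhds_zero_nat.eventually_le_const (hA.eigenvalues_pos i)
  refine tendsto_const_nhds.congr' ?_
  filter_upwards [hev] with k hk
  refine cfc_congr fun t ht => ?_
  rw [hA.isHermitian.spectrum_real_eq_range_eigenvalues] at ht
  obtain ⟨i, rfl⟩ := ht
  simp only [max_eq_left (hk i)]

theorem aestronglyMeasurable_matPow {d : ℕ} {U : Rd d → Mat n} (hU : IsMatrixWeight U) (r : ℝ) :
    AEStronglyMeasurable (fun x => matPow (U x) r) volume := by
  have hmeas : AEStronglyMeasurable U volume := by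
    have h1 : AEStronglyMeasurable (fun x i j => U x i j) volume :=
      (aemeasurable_pi_iff.2 fun i => aemeasurable_pi_iff.2 fun j =>
        (hU.1 i j).aestronglyMeasurable.aemeasurable).aestronglyMeasurable
    exact h1
  refine aestronglyMeasurable_of_tendsto_ae Filter.atTop (fun k : ℕ =>
    (continuous_cfc_selfAdjointPart (fun t : ℝ => (max t (1 / ((k : ℝ) + 1))) ^ r)
      ?_).comp_aestronglyMeasurable hmeas) ?_
  · refine Continuous.rpow_const (by fun_prop) fun t => Or.inl ?_
    exact (lt_max_of_lt_right Nat.one_div_pos_of_nat).ne'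
  · filter_upwards [hU.2] with x hx using tendsto_cfc_max_rpow hx r

end MatrixNorm

namespace IsYoungFunction

variable {Φ : ℝ → ℝ}

theorem nonneg (h : IsYoungFunction Φ) {t : ℝ} (ht : 0 ≤ t) : 0 ≤ Φ t :=
  h.map_zero ▸ h.monotoneOn Set.self_mem_Ici ht ht

theorem mono (h : IsYoungFunction Φ) {s t : ℝ} (hs : 0 ≤ s) (hst : s ≤ t) : Φ s ≤ Φ t :=
  h.monotoneOn hs (hs.trans hst) hst

theorem map_div_le (h : IsYoungFunction Φ) {t c : ℝ} (ht : 0 ≤ t) (hc : 1 ≤ c) :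
    Φ (t / c) ≤ Φ t / c := by
  have hc0 : 0 < c := one_pos.trans_le hc
  have h1 : (0 : ℝ) ≤ 1 - 1 / c := sub_nonneg.2 ((div_le_one hc0).2 hc)
  have := h.convexOn.2 (Set.mem_Ici.2 ht) Set.self_mem_Ici (one_div_pos.2 hc0).le h1 (by ring)
  simpa [h.map_zero, div_eq_inv_mul] using this

theorem measurable_comp_max (h : IsYoungFunction Φ) : Measurable fun t => Φ (max t 0) :=
  Monotone.measurable fun _ _ hst => h.mono (le_max_right _ _) (max_le_max_right 0 hst)

theorem aemeasurable_comp (h : IsYoungFunction Φ) {X : Type*} [MeasurableSpace X]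
    {μ : Measure X} {f : X → ℝ} (hf : AEMeasurable f μ) (h0 : ∀ x, 0 ≤ f x) :
    AEMeasurable (fun x => Φ (f x)) μ := by
  simpa only [Function.comp_def, max_eq_left (h0 _)] using
    h.measurable_comp_max.comp_aemeasurable hf

theorem ofReal_map_sum_le (h : IsYoungFunction Φ) {n : ℕ} (t : Fin n → ℝ) (ht : ∀ i, 0 ≤ t i) :
    ENNReal.ofReal (Φ (∑ i, t i)) ≤ ∑ i, ENNReal.ofReal (Φ ((n + 1) * t i)) := by
  rcases n.eq_zero_or_pos with rfl | hn
  · simp [h.map_zero]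
  have : Nonempty (Fin n) := ⟨⟨0, hn⟩⟩
  obtain ⟨i, hi⟩ := Finite.exists_max t
  refine le_trans (ENNReal.ofReal_le_ofReal (h.mono (Finset.sum_nonneg fun i _ => ht i) ?_))
    (Finset.single_le_sum (f := fun i => ENNReal.ofReal (Φ ((n + 1) * t i)))
      (fun _ _ => bot_le) (Finset.mem_univ i))
  calc ∑ j, t j ≤ ∑ _j : Fin n, t i := Finset.sum_le_sum fun j _ => hi j
    _ = n * t i := by simp
    _ ≤ (n + 1) * t i := by nlinarith [ht i]

end IsYoungFunction

section Luxemburg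

variable {d : ℕ} {Φ : ℝ → ℝ} {Q : Cube d}

theorem luxNormE_le {f : Rd d → ℝ≥0∞} {t : ℝ} (ht : 0 < t)
    (h : ∫⁻ x in Q.set, ENNReal.ofReal (Φ ((f x).toReal / t)) ≤ ENNReal.ofReal Q.vol) :
    luxNormE Φ Q f ≤ ENNReal.ofReal t :=
  sInf_le ⟨ENNReal.ofReal_pos.2 ht, ofReal_lt_top, by rwa [ENNReal.toReal_ofReal ht.le]⟩

theorem lintegral_le_of_luxNormE_lt (hΦ : IsYoungFunction Φ) {f : Rd d → ℝ≥0∞} {t : ℝ}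
    (h : luxNormE Φ Q f < ENNReal.ofReal t) :
    ∫⁻ x in Q.set, ENNReal.ofReal (Φ ((f x).toReal / t)) ≤ ENNReal.ofReal Q.vol := by
  obtain ⟨s, ⟨hs0, hsfin, hs⟩, hst⟩ := sInf_lt_iff.1 h
  refine le_trans (lintegral_mono fun x => ENNReal.ofReal_le_ofReal ?_) hs
  have hs0' : 0 < s.toReal := ENNReal.toReal_pos hs0.ne' hsfin.ne
  have hst' : s.toReal < t := (ENNReal.lt_ofReal_iff_toReal_lt hsfin.ne).1 hst
  have ht : 0 < t := hs0'.trans hst'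
  exact hΦ.mono (by positivity) (by gcongr)

theorem luxNorm_le {f : Rd d → ℝ} {t : ℝ} (ht : 0 < t)
    (h : ∫⁻ x in Q.set, ENNReal.ofReal (Φ (|f x| / t)) ≤ ENNReal.ofReal Q.vol) :
    luxNorm Φ Q f ≤ ENNReal.ofReal t :=
  luxNormE_le ht (by simpa only [ENNReal.toReal_ofReal (abs_nonneg _)] using h)

theorem lintegral_le_of_luxNorm_lt (hΦ : IsYoungFunction Φ) {f : Rd d → ℝ} {t : ℝ}
    (h : luxNorm Φ Q f < ENNReal.ofReal t) :
    ∫⁻ x in Q.set, ENNReal.ofReal (Φ (|f x| / t)) ≤ ENNReal.ofReal Q.vol := by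
  simpa only [ENNReal.toReal_ofReal (abs_nonneg _)] using lintegral_le_of_luxNormE_lt hΦ h

theorem luxNorm_mono (hΦ : IsYoungFunction Φ) {f g : Rd d → ℝ} (h : ∀ᵐ x, |f x| ≤ |g x|) :
    luxNorm Φ Q f ≤ luxNorm Φ Q g := by
  refine sInf_le_sInf fun s ⟨hs0, hsfin, hs⟩ => ⟨hs0, hsfin, le_trans (lintegral_mono_ae ?_) hs⟩
  filter_upwards [ae_restrict_of_ae h] with x hx
  simp only [ENNReal.toReal_ofReal (abs_nonneg _)]
  exact ENNReal.ofReal_le_ofReal (hΦ.mono (by positivity) (by gcongr))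

/-- The cubes of a disjoint family inside `Q` on which one of finitely many functions of norm less
than `t` has norm greater than `s * t` fill only a small part of `Q`. -/
theorem tsum_vol_le_of_lt_luxNorm (hΦ : IsYoungFunction Φ) {ι : Type*} [Fintype ι]
    {f : ι → Rd d → ℝ} {s t : ℝ} (hs : 1 ≤ s) (ht : 0 < t)
    (hf : ∀ i, luxNorm Φ Q (f i) < ENNReal.ofReal t) {M : Set (Cube d)} (hMc : M.Countable)
    (hdisj : M.PairwiseDisjoint Cube.set)
    (hM : ∀ R ∈ M, R.set ⊆ Q.set ∧ ∃ i, ENNReal.ofReal (s * t) < luxNorm Φ R (f i)) :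
    ENNReal.ofReal s * ∑' R : M, ENNReal.ofReal (R : Cube d).vol ≤
      Fintype.card ι * ENNReal.ofReal Q.vol := by
  have : Countable M := hMc.to_subtype
  have hs0 : 0 < s := one_pos.trans_le hs
  set g : ι → Rd d → ℝ≥0∞ := fun i x => ENNReal.ofReal (Φ (|f i x| / (s * t))) with hg
  have hR : ∀ R : M, ENNReal.ofReal (R : Cube d).vol ≤ ∑ i, ∫⁻ x in (R : Cube d).set, g i x := by
    intro R
    obtain ⟨i, hi⟩ := (hM R R.2).2
    refine le_trans (le_of_lt (lt_of_not_ge fun hle => hi.not_ge (luxNorm_le (by positivity) hle)))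
      (Finset.single_le_sum (f := fun i => ∫⁻ x in (R : Cube d).set, g i x)
        (fun _ _ => bot_le) (Finset.mem_univ i))
  have hQ : ∀ i, ENNReal.ofReal s * ∫⁻ x in Q.set, g i x ≤ ENNReal.ofReal Q.vol := by
    intro i
    refine le_trans ?_ (lintegral_le_of_luxNorm_lt hΦ (hf i))
    rw [← lintegral_const_mul' _ _ ofReal_ne_top]
    refine lintegral_mono fun x => ?_
    simp only [hg]
    rw [← ENNReal.ofReal_mul hs0.le]
    refine ENNReal.ofReal_le_ofReal ?_
    have := hΦ.map_div_le (t := |f i x| / t) (by positivity) hs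
    rwa [div_div, mul_comm t s, le_div_iff₀' hs0] at this
  calc ENNReal.ofReal s * ∑' R : M, ENNReal.ofReal (R : Cube d).vol
      ≤ ENNReal.ofReal s * ∑' R : M, ∑ i, ∫⁻ x in (R : Cube d).set, g i x := by
        gcongr with R
        exact hR R
    _ = ENNReal.ofReal s * ∑ i, ∫⁻ x in ⋃ R : M, (R : Cube d).set, g i x := by
        rw [Summable.tsum_finsetSum fun i _ => ENNReal.summable]
        congr 1
        refine Finset.sum_congr rfl fun i _ => (lintegral_iUnion
          (fun R : M => R.1.measurableSet_set) (fun R R' hne => ?_) _).symm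
        exact hdisj R.2 R'.2 (Subtype.coe_injective.ne hne)
    _ ≤ ∑ i, ENNReal.ofReal s * ∫⁻ x in Q.set, g i x := by
        rw [Finset.mul_sum]
        gcongr
        exact Set.iUnion_subset fun R => (hM R R.2).1
    _ ≤ ∑ _i : ι, ENNReal.ofReal Q.vol := Finset.sum_le_sum fun i _ => hQ i
    _ = Fintype.card ι * ENNReal.ofReal Q.vol := by simp

theorem luxNorm_sum_lt_top (hΦ : IsYoungFunction Φ) {n : ℕ} {f : Fin n → Rd d → ℝ}
    (hmeas : ∀ i, AEMeasurable (f i)) (h0 : ∀ i x, 0 ≤ f i x)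
    (hf : ∀ i, luxNorm Φ Q (f i) < ⊤) {B : ℝ} (hB : 0 ≤ B) :
    luxNorm Φ Q (fun x => B * ∑ i, f i x) < ⊤ := by
  obtain ⟨L, hL0, hL⟩ : ∃ L : ℝ, 0 < L ∧ ∀ i, luxNorm Φ Q (f i) < ENNReal.ofReal L := by
    refine ⟨∑ i, (luxNorm Φ Q (f i)).toReal + 1, by positivity, fun i => ?_⟩
    rw [ENNReal.lt_ofReal_iff_toReal_lt (hf i).ne]
    exact lt_add_of_le_of_pos (Finset.single_le_sum
      (f := fun i => (luxNorm Φ Q (f i)).toReal) (fun _ _ => ENNReal.toReal_nonneg)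
      (Finset.mem_univ i)) one_pos
  set N : ℝ := n + 1 with hN
  have hN1 : 1 ≤ N := by simp [hN]
  have hN0 : 0 < N := one_pos.trans_le hN1
  refine (luxNorm_le (t := N * N * (B + 1) * L) (by positivity) ?_).trans_lt ofReal_lt_top
  calc ∫⁻ x in Q.set, ENNReal.ofReal (Φ (|B * ∑ i, f i x| / (N * N * (B + 1) * L)))
      ≤ ∫⁻ x in Q.set, ∑ i, ENNReal.ofReal (1 / N) * ENNReal.ofReal (Φ (f i x / L)) := by
        refine lintegral_mono fun x => ?_
        have hsum : |B * ∑ i, f i x| / (N * N * (B + 1) * L) ≤ ∑ i, f i x / (N * N * L) := by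
          have hS : 0 ≤ ∑ i, f i x := Finset.sum_nonneg fun i _ => h0 i x
          rw [abs_of_nonneg (by positivity), ← Finset.sum_div, div_le_div_iff₀ (by positivity)
            (by positivity)]
          have : 0 ≤ (∑ i, f i x) * (N * N * L) := by positivity
          nlinarith
        refine (ENNReal.ofReal_le_ofReal (hΦ.mono (by positivity) hsum)).trans
          ((hΦ.ofReal_map_sum_le _ fun i => div_nonneg (h0 i x) (by positivity)).trans ?_)
        refine Finset.sum_le_sum fun i _ => ?_
        rw [← ENNReal.ofReal_mul (by positivity)]
        refine ENNReal.ofReal_le_ofReal ?_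
        have := hΦ.map_div_le (t := f i x / L) (div_nonneg (h0 i x) hL0.le) hN1
        have he : (n + 1 : ℝ) * (f i x / (N * N * L)) = f i x / L / N := by
          rw [← hN]
          field_simp
        rw [he, one_div, ← div_eq_inv_mul]
        exact this
    _ = ∑ i, ENNReal.ofReal (1 / N) * ∫⁻ x in Q.set, ENNReal.ofReal (Φ (f i x / L)) := by
        have hm : ∀ i, AEMeasurable (fun x => ENNReal.ofReal (Φ (f i x / L)))
            (volume.restrict Q.set) := fun i =>
          (hΦ.aemeasurable_comp ((hmeas i).restrict.div_const L) fun x =>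
            div_nonneg (h0 i x) hL0.le).ennreal_ofReal
        rw [lintegral_finsetSum' _ fun i _ => (hm i).const_mul _]
        exact Finset.sum_congr rfl fun i _ => lintegral_const_mul' _ _ ofReal_ne_top
    _ ≤ ∑ _i : Fin n, ENNReal.ofReal (1 / N) * ENNReal.ofReal Q.vol := by
        refine Finset.sum_le_sum fun i _ => mul_le_mul_right ?_ _
        simpa only [abs_of_nonneg (h0 i _)] using lintegral_le_of_luxNorm_lt hΦ (hL i)
    _ ≤ ENNReal.ofReal Q.vol := by
        rw [Finset.sum_const, Finset.card_univ, Fintype.card_fin, nsmul_eq_mul, ← mul_assoc,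
          ← ENNReal.ofReal_natCast, ← ENNReal.ofReal_mul (by positivity)]
        refine mul_le_of_le_one_left bot_le (ENNReal.ofReal_le_one.2 ?_)
        rw [mul_one_div, div_le_one hN0]
        simp [hN]

end Luxemburg

section Reducing

variable {d n : ℕ} {c₁ c₂ : ℝ} {Φ : ℝ → ℝ} {W : Rd d → Mat n} {R : Cube d} {M : Mat n}

theorem ReducesOrlicz.luxNorm_le (h : ReducesOrlicz c₁ c₂ Φ W R M) (hc₁ : 0 < c₁) (e : Cn n) :
    luxNorm Φ R (fun x => ‖mulVecE (W x) e‖) ≤ ENNReal.ofReal (‖mulVecE M e‖ / c₁) := by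
  rw [ENNReal.ofReal_div_of_pos hc₁, ENNReal.le_div_iff_mul_le (by simp [hc₁]) (by simp),
    mul_comm, ofReal_norm]
  exact (h.2 e).1

/-- The norm of `A M` is controlled by the Luxemburg norm of `|A W|`, for self-adjoint `A`, `W`. -/
theorem ReducesOrlicz.opNorm_mul_le (h : ReducesOrlicz c₁ c₂ Φ W R M) (hΦ : IsYoungFunction Φ)
    (hc₂ : 0 < c₂) (hW : ∀ᵐ x, (W x).IsHermitian) {A : Mat n} (hA : A.IsHermitian)
    (hfin : luxNorm Φ R (fun y => opNorm (A * W y)) ≠ ⊤) :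
    opNorm (A * M) ≤ n * (c₂ * (luxNorm Φ R (fun y => opNorm (A * W y))).toReal) := by
  have hMA : opNorm (A * M) = opNorm (M * A) := by
    rw [← opNorm_conjTranspose, Matrix.conjTranspose_mul, hA.eq, h.1.isHermitian.eq]
  rw [hMA]
  refine (opNorm_le_sum _).trans ?_
  have hi : ∀ i : Fin n, ‖mulVecE (M * A) (EuclideanSpace.single i 1)‖ ≤
      c₂ * (luxNorm Φ R (fun y => opNorm (A * W y))).toReal := by
    intro i
    have hlux : luxNorm Φ R
        (fun y => ‖mulVecE (W y) (mulVecE A (EuclideanSpace.single i 1))‖) ≤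
        luxNorm Φ R (fun y => opNorm (A * W y)) := by
      refine luxNorm_mono hΦ ?_
      filter_upwards [hW] with y hy
      rw [abs_of_nonneg (norm_nonneg _), abs_of_nonneg (opNorm_nonneg _), mulVecE_mulVecE]
      have hAW : opNorm (A * W y) = opNorm (W y * A) := by
        rw [← opNorm_conjTranspose, Matrix.conjTranspose_mul, hA.eq, hy.eq]
      rw [hAW]
      simpa using norm_mulVecE_le (W y * A) (EuclideanSpace.single i 1)
    have h2 := ((h.2 (mulVecE A (EuclideanSpace.single i 1))).2.trans
      (mul_le_mul_right hlux _))
    have h3 := ENNReal.toReal_mono (ENNReal.mul_ne_top ofReal_ne_top hfin) h2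
    rw [ENNReal.toReal_mul, ENNReal.toReal_ofReal hc₂.le] at h3
    rwa [mulVecE_mulVecE] at h3
  calc ∑ i : Fin n, ‖mulVecE (M * A) (EuclideanSpace.single i 1)‖
      ≤ ∑ _i : Fin n, c₂ * (luxNorm Φ R (fun y => opNorm (A * W y))).toReal :=
        Finset.sum_le_sum fun i _ => hi i
    _ = n * (c₂ * (luxNorm Φ R (fun y => opNorm (A * W y))).toReal) := by simp

theorem ReducesOrlicz.luxNorm_opNorm_lt_top (h : ReducesOrlicz c₁ c₂ Φ W R M)
    (hΦ : IsYoungFunction Φ) (hc₁ : 0 < c₁) (hW : AEStronglyMeasurable W volume) (A : Mat n) :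
    luxNorm Φ R (fun y => opNorm (A * W y)) < ⊤ := by
  refine lt_of_le_of_lt (luxNorm_mono hΦ ?_) (luxNorm_sum_lt_top (Q := R) hΦ
    (f := fun i y => ‖mulVecE (W y) (EuclideanSpace.single i 1)‖) (fun i => ?_)
    (fun _ _ => norm_nonneg _)
    (fun i => (h.luxNorm_le hc₁ _).trans_lt ofReal_lt_top) (opNorm_nonneg A))
  · refine Filter.Eventually.of_forall fun y => ?_
    rw [abs_of_nonneg (opNorm_nonneg _), abs_of_nonneg (mul_nonneg (opNorm_nonneg _)
      (Finset.sum_nonneg fun _ _ => norm_nonneg _))]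
    exact (_root_.opNorm_mul_le _ _).trans
      (mul_le_mul_of_nonneg_left (opNorm_le_sum _) (opNorm_nonneg _))
  · exact ((continuous_mulVecE _).norm.comp_aestronglyMeasurable hW).aemeasurable

/-- If the reducing operators `M` on `Q` and `M'` on `R` differ by a large factor, then some column
of `W M⁻¹` has a large norm on `R`. -/
theorem ReducesOrlicz.exists_lt_luxNorm {M' : Mat n} (h' : ReducesOrlicz c₁ c₂ Φ W R M')
    (hM : M.IsHermitian) (hc₂ : 0 < c₂) {t : ℝ} (ht : 0 ≤ t)
    (hlt : n * (c₂ * t) < opNorm (M⁻¹ * M')) :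
    ∃ i : Fin n, ENNReal.ofReal t < luxNorm Φ R
      (fun x => ‖mulVecE (W x) (mulVecE M⁻¹ (EuclideanSpace.single i 1))‖) := by
  by_contra! hcon
  have hswap : opNorm (M⁻¹ * M') = opNorm (M' * M⁻¹) := by
    rw [← opNorm_conjTranspose, Matrix.conjTranspose_mul, hM.inv.eq, h'.1.isHermitian.eq]
  rw [hswap] at hlt
  refine hlt.not_ge ((opNorm_le_sum _).trans ?_)
  calc ∑ i : Fin n, ‖mulVecE (M' * M⁻¹) (EuclideanSpace.single i 1)‖
      ≤ ∑ _i : Fin n, c₂ * t := by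
        refine Finset.sum_le_sum fun i _ => ?_
        have h2 := ((h'.2 (mulVecE M⁻¹ (EuclideanSpace.single i 1))).2.trans
          (mul_le_mul_right (hcon i) _))
        have h3 := ENNReal.toReal_mono (ENNReal.mul_ne_top ofReal_ne_top ofReal_ne_top) h2
        rw [ENNReal.toReal_mul, ENNReal.toReal_ofReal hc₂.le, ENNReal.toReal_ofReal ht] at h3
        rwa [mulVecE_mulVecE] at h3
    _ = n * (c₂ * t) := by simp

end Reducing

/-- A bound for the Luxemburg norm of a supremum by an integral of the suprema of `Ψ`. -/
theorem luxNormE_iSup_le {d : ℕ} {Ψ : ℝ → ℝ} (hΨ : IsYoungFunction Ψ) {𝒟 : Set (Cube d)}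
    {g : Cube d → Rd d → ℝ} (hg : ∀ R x, 0 ≤ g R x) {Q : Cube d} {t : ℝ} (ht : 0 < t)
    (h : ∫⁻ x in Q.set, ⨆ k : ℕ, truncMax 𝒟 (fun R x => ENNReal.ofReal (Ψ (g R x / t)))
      (1 / ((k : ℝ) + 1)) Q x ≤ 2 * ENNReal.ofReal Q.vol) :
    luxNormE Ψ Q (fun x => ⨆ (R : Cube d) (_ : R ∈ 𝒟) (_ : R.set ⊆ Q.set) (_ : x ∈ R.set),
      ENNReal.ofReal (g R x)) ≤ ENNReal.ofReal (4 * t) := by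
  refine luxNormE_le (by positivity) ?_
  set N : Rd d → ℝ≥0∞ := fun x => ⨆ (R : Cube d) (_ : R ∈ 𝒟) (_ : R.set ⊆ Q.set)
    (_ : x ∈ R.set), ENNReal.ofReal (g R x) with hN
  have hpt : ∀ x, ENNReal.ofReal (Ψ ((N x).toReal / (4 * t))) ≤
      2⁻¹ * ⨆ k : ℕ, truncMax 𝒟 (fun R x => ENNReal.ofReal (Ψ (g R x / t)))
        (1 / ((k : ℝ) + 1)) Q x := by
    intro x
    rcases (ENNReal.toReal_nonneg (a := N x)).eq_or_lt with h0 | h0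
    · simp [← h0, hΨ.map_zero]
    have hlt : ENNReal.ofReal ((N x).toReal / 2) < N x := by
      rw [ENNReal.ofReal_lt_iff_lt_toReal (by positivity) (ENNReal.toReal_pos_iff.1 h0).2.ne]
      linarith
    simp only [hN, lt_iSup_iff] at hlt
    obtain ⟨R, hR, hRQ, hx, hlt⟩ := hlt
    obtain ⟨k, hk⟩ := exists_nat_one_div_lt R.side_pos
    have hlt' := (ENNReal.ofReal_lt_ofReal_iff_of_nonneg (by positivity)).1 hlt
    calc ENNReal.ofReal (Ψ ((N x).toReal / (4 * t)))
        ≤ 2⁻¹ * ENNReal.ofReal (Ψ (g R x / t)) := by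
          rw [← ENNReal.ofReal_ofNat 2, ← ENNReal.ofReal_inv_of_pos two_pos,
            ← ENNReal.ofReal_mul (by positivity)]
          refine ENNReal.ofReal_le_ofReal ?_
          have h1 := hΨ.map_div_le (div_nonneg (hg R x) ht.le) one_le_two
          rw [div_eq_inv_mul (Ψ _)] at h1
          refine (hΨ.mono (by positivity) ?_).trans h1
          rw [div_div, div_le_div_iff₀ (by positivity) (by positivity)]
          simp only [hN] at *
          nlinarith
      _ ≤ _ := by
          gcongr
          exact le_iSup_of_le k (le_truncMax (fun R x => ENNReal.ofReal (Ψ (g R x / t)))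
            hR hRQ hk.le hx)
  refine (lintegral_mono hpt).trans ?_
  rw [lintegral_const_mul' _ _ (by simp)]
  refine (mul_le_mul_right h _).trans ?_
  rw [← mul_assoc, ENNReal.inv_mul_cancel two_ne_zero ofNat_ne_top, one_mul]

/-- **Lemma 4.1.**  If `(U,V)` satisfies the bump condition `[U,V]_{p,q,Φ,Ψ} < ∞`, then the
localized Orlicz norms `‖N_Q‖_{Ψ,Q}` are uniformly bounded over the dyadic grid. -/
theorem NQ_Orlicz_bound {d n : ℕ} (α p q : ℝ)
    (hα0 : 0 ≤ α) (hαd : α < d) (hp : 1 < p) (hpq : p ≤ q)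
    (hexp : 1 / p - 1 / q ≤ α / (d : ℝ))
    (Φ Ψ : ℝ → ℝ) (hΦ : IsYoungFunction Φ) (hΨ : IsYoungFunction Ψ)
    (𝒟 : Set (Cube d)) (h𝒟 : IsDyadicGrid 𝒟)
    (U V : Rd d → Mat n) (hU : IsMatrixWeight U) (hV : IsMatrixWeight V)
    (c₁ c₂ : ℝ) (hc₁ : 0 < c₁) (hc₂ : 0 < c₂)
    (𝒱 : Cube d → Mat n)
    (h𝒱 : ∀ R ∈ 𝒟, ReducesOrlicz c₁ c₂ Φ (fun x => matPow (V x) (-(1 / p))) R (𝒱 R))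
    (hbump : bumpTwo α p q Φ Ψ U V < ⊤) :
    (⨆ Q ∈ 𝒟, luxNormE Ψ Q (NQfun α p q 𝒟 U 𝒱 Q)) < ⊤ := by
  have hd : 0 < d := by
    have : (0 : ℝ) < d := hα0.trans_lt hαd
    exact_mod_cast this
  set γ : ℝ := α / (d : ℝ) + 1 / q - 1 / p with hγ
  have hγ0 : 0 ≤ γ := by linarith
  set W : Rd d → Mat n := fun x => matPow (V x) (-(1 / p)) with hW
  have hWm : AEStronglyMeasurable W volume := aestronglyMeasurable_matPow hV _
  have hWh : ∀ᵐ x, (W x).IsHermitian := by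
    filter_upwards [hV.2] with x hx using isHermitian_matPow hx.isHermitian _
  set K : ℝ := (bumpTwo α p q Φ Ψ U V).toReal + 1 with hK
  have hK0 : 0 < K := by positivity
  set s : ℝ := 2 * (n + 1) with hs
  have hs1 : 1 ≤ s := by
    have : (0 : ℝ) ≤ n := n.cast_nonneg
    linarith
  set t : ℝ := 2 / c₁ with ht
  have ht0 : 0 < t := by positivity
  set a : ℝ := n * (c₂ * (s * t)) + 1 with ha
  have ha1 : 1 ≤ a := by
    have : 0 ≤ n * (c₂ * (s * t)) := by positivity
    linarith
  set b : ℝ := (n + 1) * c₂ * K with hb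
  have hb0 : 0 < b := by positivity
  set g : Cube d → Rd d → ℝ :=
    fun R x => R.vol ^ γ * opNorm (matPow (U x) (1 / q) * 𝒱 R) with hg
  have hvγ : ∀ R : Cube d, 0 < R.vol ^ γ := fun R => Real.rpow_pos_of_pos R.vol_pos _
  have hg0 : ∀ R x, 0 ≤ g R x := fun R x => mul_nonneg (hvγ R).le (opNorm_nonneg _)
  have hgm : ∀ R, AEMeasurable (g R) := fun R =>
    ((continuous_opNorm.comp (continuous_id.mul continuous_const)).comp_aestronglyMeasurable
      (aestronglyMeasurable_matPow hU (1 / q))).aemeasurable.const_mul _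
  have hΨm : ∀ R (r : ℝ), 0 < r → AEMeasurable fun x => ENNReal.ofReal (Ψ (g R x / r)) :=
    fun R r hr => (hΨ.aemeasurable_comp ((hgm R).div_const r)
      fun x => div_nonneg (hg0 R x) hr.le).ennreal_ofReal
  have hEint : ∀ Q ∈ 𝒟, ∫⁻ x in Q.set, ENNReal.ofReal (Ψ (g Q x / b)) ≤
      ENNReal.ofReal Q.vol := by
    intro Q hQ
    have hlt : luxNormE Ψ Q (fun x => luxNorm Φ Q fun y =>
        opNorm (matPow (U x) (1 / q) * W y)) < ENNReal.ofReal (K / Q.vol ^ γ) := by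
      have h1 : ENNReal.ofReal (Q.vol ^ γ) * luxNormE Ψ Q (fun x => luxNorm Φ Q fun y =>
          opNorm (matPow (U x) (1 / q) * W y)) ≤ bumpTwo α p q Φ Ψ U V :=
        le_iSup (fun Q : Cube d => ENNReal.ofReal (Q.vol ^ γ) * luxNormE Ψ Q (fun x =>
          luxNorm Φ Q fun y => opNorm (matPow (U x) (1 / q) * W y))) Q
      have h2 : bumpTwo α p q Φ Ψ U V < ENNReal.ofReal K := by
        rw [ENNReal.lt_ofReal_iff_toReal_lt hbump.ne]
        exact lt_add_one _
      rw [ENNReal.ofReal_div_of_pos (hvγ Q),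
        ENNReal.lt_div_iff_mul_lt (by simp [hvγ Q]) (by simp), mul_comm]
      exact h1.trans_lt h2
    refine le_trans (lintegral_mono_ae ?_) (lintegral_le_of_luxNormE_lt hΨ hlt)
    filter_upwards [ae_restrict_of_ae hU.2] with x hx
    refine ENNReal.ofReal_le_ofReal (hΨ.mono (div_nonneg (hg0 Q x) hb0.le) ?_)
    have h1 := (h𝒱 Q hQ).opNorm_mul_le hΦ hc₂ hWh
      (isHermitian_matPow hx.isHermitian (1 / q))
      ((h𝒱 Q hQ).luxNorm_opNorm_lt_top hΦ hc₁ hWm _).ne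
    set h : ℝ := (luxNorm Φ Q fun y => opNorm (matPow (U x) (1 / q) * W y)).toReal
    have hh : 0 ≤ h := ENNReal.toReal_nonneg
    rw [div_div_eq_mul_div, div_le_div_iff₀ hb0 hK0]
    calc g Q x * K ≤ Q.vol ^ γ * (n * (c₂ * h)) * K := by
          have := hvγ Q
          simp only [hg]
          gcongr
      _ ≤ Q.vol ^ γ * ((n + 1) * (c₂ * h)) * K := by
          have := hvγ Q
          gcongr
          linarith
      _ = h * Q.vol ^ γ * b := by
          rw [hb]
          ring
  have hmain : ∀ Q ∈ 𝒟, ∀ r : ℝ, 0 < r →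
      ∫⁻ x in Q.set, truncMax 𝒟 (fun R x => ENNReal.ofReal (Ψ (g R x / (a * b)))) r Q x ≤
        2 * ENNReal.ofReal Q.vol := by
    intro Q hQ r hr
    refine setLIntegral_truncMax_le hd h𝒟 (E := fun R x => ENNReal.ofReal (Ψ (g R x / b)))
      (jump := fun Q R => a < opNorm ((𝒱 Q)⁻¹ * 𝒱 R)) (fun R _ => hΨm R _ (by positivity))
      (fun R _ => hΨm R b hb0) hEint ?_ ?_ ?_ hr hQ
    · intro Q hQ R hR hRQ hjump x
      refine ENNReal.ofReal_le_ofReal (hΨ.mono (div_nonneg (hg0 R x) (by positivity)) ?_)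
      rw [div_le_div_iff₀ (by positivity) hb0]
      have hvol : R.vol ^ γ ≤ Q.vol ^ γ := Real.rpow_le_rpow R.vol_pos.le
        (pow_le_pow_left₀ R.side_pos.le (Cube.side_le_of_subset hd hRQ) d) hγ0
      have hdet : IsUnit (𝒱 Q).det :=
        (Matrix.isUnit_iff_isUnit_det _).1 (h𝒱 Q hQ).1.isUnit
      have hop : opNorm (matPow (U x) (1 / q) * 𝒱 R) ≤
          opNorm (matPow (U x) (1 / q) * 𝒱 Q) * a := by
        have heq : matPow (U x) (1 / q) * 𝒱 R =
            matPow (U x) (1 / q) * 𝒱 Q * ((𝒱 Q)⁻¹ * 𝒱 R) := by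
          rw [Matrix.mul_assoc, Matrix.mul_nonsing_inv_cancel_left _ _ hdet]
        rw [heq]
        exact (opNorm_mul_le _ _).trans
          (mul_le_mul_of_nonneg_left (not_lt.1 hjump) (opNorm_nonneg _))
      calc g R x * b ≤ Q.vol ^ γ * (opNorm (matPow (U x) (1 / q) * 𝒱 Q) * a) * b := by
            have := opNorm_nonneg (matPow (U x) (1 / q) * 𝒱 R)
            have := hvγ Q
            simp only [hg]
            gcongr
        _ = g Q x * (a * b) := by
            simp only [hg]
            ring
    · intro Q hQ
      have hdet : IsUnit (𝒱 Q).det :=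
        (Matrix.isUnit_iff_isUnit_det _).1 (h𝒱 Q hQ).1.isUnit
      rw [Matrix.nonsing_inv_mul _ hdet, not_lt]
      exact (opNorm_one_le n).trans ha1
    · intro Q hQ M hM hdisj
      have hdet : IsUnit (𝒱 Q).det :=
        (Matrix.isUnit_iff_isUnit_det _).1 (h𝒱 Q hQ).1.isUnit
      have hsmall : ∀ i : Fin n, luxNorm Φ Q (fun x =>
          ‖mulVecE (W x) (mulVecE (𝒱 Q)⁻¹ (EuclideanSpace.single i 1))‖) <
            ENNReal.ofReal t := by
        intro i
        refine ((h𝒱 Q hQ).luxNorm_le hc₁ _).trans_lt ?_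
        rw [ENNReal.ofReal_lt_ofReal_iff ht0, mulVecE_mulVecE,
          Matrix.mul_nonsing_inv _ hdet, ht]
        gcongr
        refine ((norm_mulVecE_le _ _).trans_lt ?_)
        have := opNorm_one_le n
        simp only [PiLp.norm_single, norm_one, mul_one]
        linarith
      have hsum := tsum_vol_le_of_lt_luxNorm hΦ hs1 ht0 hsmall
        (h𝒟.countable.mono fun R hR => (hM hR).1) hdisj fun R hR => ⟨(hM hR).2.1,
          (h𝒱 R (hM hR).1).exists_lt_luxNorm (h𝒱 Q hQ).1.isHermitian hc₂ (by positivity)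
            ((lt_add_one _).trans (hM hR).2.2)⟩
      have hs2 : ENNReal.ofReal s = (n + 1) * 2 := by
        rw [hs, mul_comm, ENNReal.ofReal_mul (by positivity),
          ENNReal.ofReal_add (by positivity) zero_le_one]
        simp
      rw [hs2, Fintype.card_fin, mul_assoc] at hsum
      have hn : ((n : ℝ≥0∞) + 1) ≠ 0 := by simp
      have hn' : ((n : ℝ≥0∞) + 1) ≠ ⊤ := by simp
      refine (ENNReal.mul_le_mul_iff_right hn hn').1 (hsum.trans ?_)
      gcongr
      exact le_self_add
  refine lt_of_le_of_lt (iSup₂_le fun Q hQ => ?_)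
    (ofReal_lt_top (r := 4 * (a * b)))
  exact luxNormE_iSup_le hΨ hg0 (by positivity)
    (setLIntegral_iSup_truncMax_le h𝒟 (fun R _ => hΨm R _ (by positivity)) (hmain Q hQ))

end
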